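/- Let g : ℕ → ℤ be a normalized arithmetic function (g(1) = 1) such that P_n^g(x) is an integer-valued polynomial for all n ≥ 1. Let A_n^g(x) := n! · P_n^g(x) ∈ ℤ[x]. Assume: (1) no monic irreducible polynomial of degree 2 over 𝔽₅ divides the reduction mod 5 of A_3^g or of A_4^g; (2) no monic irreducible polynomial of degree 4 over 𝔽₇ divides the reduction mod 7 of A_r^g for any 2 ≤ r ≤ 6; (3) no monic irreducible polynomial over 𝔽₁₁ that divides x^{11^6 − 1} − 1 but does not divide x^{11^d − 1} − 1 for any 1 ≤ d ≤ 10 with d ≠ 6 divides the reduction mod 11 of A_r^g for any 2 ≤ r ≤ 10. Then for every m ≥ 3, every primitive m-th root of unity ζ in ℂ, and every n ≥ 1, P_n^g(ζ) ≠ 0. -/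

import Mathlib

open Polynomial

/-- The polynomials `P_n^g ∈ ℚ[X]` defined by `P_0^g = 1` and
`P_n^g = (x/n) ∑_{k=1}^n g(k) P_{n-k}^g` for `n ≥ 1`. -/
noncomputable def darcais (g : ℕ → ℤ) : ℕ → ℚ[X]
  | 0 => 1
  | n + 1 =>
      C (((n : ℚ) + 1)⁻¹) * X *
        ∑ k ∈ Finset.range (n + 1), C ((g (k + 1) : ℚ)) * darcais g (n - k)
  decreasing_by exact Nat.sub_lt_succ n k

/-- `A_n^g := n! ⬝ P_n^g`. -/
noncomputable def darcaisA (g : ℕ → ℤ) (n : ℕ) : ℚ[X] :=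
  (n.factorial : ℚ[X]) * darcais g n

/-- Sum-of-divisors function `σ` as a `ℤ`-valued arithmetic function. -/
def sigma' (n : ℕ) : ℤ := ∑ d ∈ n.divisors, (d : ℤ)

/-- The integer polynomials `n! ⬝ P_n^g`, defined by their own recursion. -/
noncomputable def darcaisInt (g : ℕ → ℤ) : ℕ → ℤ[X]
  | 0 => 1
  | n + 1 =>
      X * ∑ k ∈ Finset.range (n + 1),
        C (g (k + 1) * (n.descFactorial k : ℤ)) * darcaisInt g (n - k)
  decreasing_by exact Nat.sub_lt_succ n k

theorem map_darcaisInt (g : ℕ → ℤ) (n : ℕ) :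
    (darcaisInt g n).map (Int.castRingHom ℚ) = C (n.factorial : ℚ) * darcais g n := by
  induction n using Nat.strong_induction_on with
  | _ n ih =>
    cases n with
    | zero => simp [darcaisInt, darcais]
    | succ n =>
      have hc : C ((n + 1).factorial : ℚ) * (C (((n : ℚ) + 1)⁻¹) * X) =
          C (n.factorial : ℚ) * X := by
        rw [← mul_assoc, ← C_mul]
        congr 2
        have : (n : ℚ) + 1 ≠ 0 := by positivity
        rw [Nat.factorial_succ]
        push_cast
        field_simp
      rw [darcaisInt, darcais, ← mul_assoc (C ((n + 1).factorial : ℚ)), hc, Polynomial.map_mul,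
        map_X, Polynomial.map_sum, mul_comm (C _) X, mul_assoc, Finset.mul_sum]
      rw [Finset.mul_sum, Finset.mul_sum]
      refine Finset.sum_congr rfl fun k hk => ?_
      rw [Polynomial.map_mul, ih (n - k) (by omega), map_C,
        ← Nat.factorial_mul_descFactorial (Finset.mem_range_succ_iff.1 hk)]
      simp only [eq_intCast, Int.cast_mul, Int.cast_natCast, Nat.cast_mul, C_mul]
      ring

theorem aeval_darcaisInt_eq_zero {g : ℕ → ℤ} {n : ℕ} {z : ℂ}
    (h : aeval z (darcais g n) = 0) : aeval z (darcaisInt g n) = 0 := by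
  have := congrArg (aeval z) (map_darcaisInt g n)
  rw [map_mul, h, mul_zero, ← algebraMap_int_eq, aeval_map_algebraMap] at this
  exact this

theorem aeval_darcaisInt_succ {R : Type*} [CommRing R] (g : ℕ → ℤ) (n : ℕ) (z : R) :
    aeval z (darcaisInt g (n + 1)) =
      z * ∑ k ∈ Finset.range (n + 1),
        g (k + 1) * (n.descFactorial k : R) * aeval z (darcaisInt g (n - k)) := by
  simp [darcaisInt]

theorem aeval_darcaisInt_add {R : Type*} [CommRing R] {p : ℕ} [CharP R p] (g : ℕ → ℤ)
    (l r : ℕ) (z : R) :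
    aeval z (darcaisInt g (p * l + r)) =
      aeval z (darcaisInt g (p * l)) * aeval z (darcaisInt g r) := by
  induction r using Nat.strong_induction_on with
  | _ r ih =>
    cases r with
    | zero => simp [darcaisInt]
    | succ r =>
      have hdesc (k : ℕ) : ((p * l + r).descFactorial k : R) = (r.descFactorial k : R) := by
        rw [← descPochhammer_eval_eq_descFactorial, ← descPochhammer_eval_eq_descFactorial]
        simp
      rw [← add_assoc, aeval_darcaisInt_succ, aeval_darcaisInt_succ, mul_left_comm]
      congr 1
      rw [Finset.mul_sum]
      refine (Finset.sum_subset_zero_on_sdiff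
        (Finset.range_subset_range.2 (by omega : r + 1 ≤ p * l + r + 1))
        (fun k hk => ?_) fun k hk => ?_).symm
      · rw [hdesc, Nat.descFactorial_eq_zero_iff_lt.2]
        · simp
        · simp only [Finset.mem_sdiff, Finset.mem_range] at hk
          omega
      · have hk := Finset.mem_range_succ_iff.1 hk
        rw [hdesc, Nat.add_sub_assoc hk, ih _ (by omega)]
        ring

/-- In characteristic `p`, a zero of some `A_n^g` is a zero of `A_r^g` with `1 ≤ r ≤ p`. -/
theorem exists_aeval_darcaisInt_eq_zero {R : Type*} [CommRing R] [IsDomain R] {p : ℕ}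
    [CharP R p] (hp : 0 < p) {g : ℕ → ℤ} {n : ℕ} {z : R}
    (h : aeval z (darcaisInt g n) = 0) :
    ∃ r, 1 ≤ r ∧ r ≤ p ∧ aeval z (darcaisInt g r) = 0 := by
  by_contra! hr
  have hmul (l : ℕ) : aeval z (darcaisInt g (p * l)) ≠ 0 := by
    induction l with
    | zero => simp [darcaisInt]
    | succ l ih =>
      rw [Nat.mul_succ, aeval_darcaisInt_add]
      exact mul_ne_zero ih (hr p hp le_rfl)
  rw [← Nat.div_add_mod n p, aeval_darcaisInt_add] at h
  have hmod := (mul_eq_zero.1 h).resolve_left (hmul _)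
  rcases Nat.eq_zero_or_pos (n % p) with h0 | h0
  · simp [h0, darcaisInt] at hmod
  · exact hr _ h0 (Nat.mod_lt n hp).le hmod

theorem aeval_darcaisInt_one {R : Type*} [CommRing R] {g : ℕ → ℤ} (hg1 : g 1 = 1) (z : R) :
    aeval z (darcaisInt g 1) = z := by
  simp [darcaisInt, hg1]

theorem aeval_darcaisInt_two {R : Type*} [CommRing R] {g : ℕ → ℤ} (hg1 : g 1 = 1) (z : R) :
    aeval z (darcaisInt g 2) = z * (z + g 2) := by
  simp [darcaisInt, hg1, Finset.sum_range_succ]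

theorem aeval_darcaisInt_three {R : Type*} [CommRing R] {g : ℕ → ℤ} (hg1 : g 1 = 1) (z : R) :
    aeval z (darcaisInt g 3) = z * (z ^ 2 + 3 * g 2 * z + 2 * g 3) := by
  simp [darcaisInt, hg1, Finset.sum_range_succ, Nat.descFactorial, map_ofNat]
  ring

theorem three_dvd_sub_one {g : ℕ → ℤ} (hg1 : g 1 = 1)
    (hint : ∃ z : ℤ, (darcais g 3).eval 1 = (z : ℚ)) : (3 : ℤ) ∣ g 3 - 1 := by
  obtain ⟨w, hw⟩ := hint
  have h := congrArg (aeval (1 : ℚ)) (map_darcaisInt g 3)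
  rw [← algebraMap_int_eq, aeval_map_algebraMap, aeval_darcaisInt_three hg1, map_mul, aeval_C,
    coe_aeval_eq_eval, hw] at h
  norm_num [Nat.factorial] at h
  have h' : 1 + 3 * g 2 + 2 * g 3 = 6 * w := by exact_mod_cast h
  omega

theorem eq_one_of_aeval_darcaisInt_eq_zero {R : Type*} [CommRing R] [IsDomain R] [CharP R 2]
    {g : ℕ → ℤ} (hg1 : g 1 = 1) {n : ℕ} {z : R} (hz : z ≠ 0)
    (h : aeval z (darcaisInt g n) = 0) : z = 1 := by
  obtain ⟨r, hr1, hr2, hr⟩ := exists_aeval_darcaisInt_eq_zero (p := 2) two_pos h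
  interval_cases r
  · rw [aeval_darcaisInt_one hg1] at hr
    exact absurd hr hz
  · rw [aeval_darcaisInt_two hg1] at hr
    have hz' : z = g 2 := by
      rw [eq_neg_of_add_eq_zero_left ((mul_eq_zero.1 hr).resolve_left hz), CharTwo.neg_eq]
    have h2 : ¬ (2 : ℤ) ∣ g 2 := fun hd => hz (hz' ▸ (CharP.intCast_eq_zero_iff R 2 _).2 hd)
    have h1 := (CharP.intCast_eq_zero_iff R 2 (g 2 - 1)).2 (by push_cast; omega)
    rw [Int.cast_sub, Int.cast_one, ← hz'] at h1
    exact sub_eq_zero.1 h1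

theorem sq_eq_one_of_aeval_darcaisInt_eq_zero {R : Type*} [CommRing R] [IsDomain R]
    [CharP R 3] {g : ℕ → ℤ} (hg1 : g 1 = 1) (hg3 : (3 : ℤ) ∣ g 3 - 1) {n : ℕ} {z : R}
    (hz : z ≠ 0) (h : aeval z (darcaisInt g n) = 0) : z ^ 2 = 1 := by
  obtain ⟨r, hr1, hr2, hr⟩ := exists_aeval_darcaisInt_eq_zero (p := 3) three_pos h
  interval_cases r
  · rw [aeval_darcaisInt_one hg1] at hr
    exact absurd hr hz
  · rw [aeval_darcaisInt_two hg1] at hr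
    have hz' : z = ((-g 2 : ℤ) : R) := by
      rw [eq_neg_of_add_eq_zero_left ((mul_eq_zero.1 hr).resolve_left hz), Int.cast_neg]
    have h3 : ¬ (3 : ℤ) ∣ -g 2 := fun hd => hz (hz' ▸ (CharP.intCast_eq_zero_iff R 3 _).2 hd)
    have hdvd : (3 : ℤ) ∣ (-g 2 - 1) * (-g 2 + 1) := by
      have : (3 : ℤ) ∣ -g 2 - 1 ∨ (3 : ℤ) ∣ -g 2 + 1 := by omega
      exact this.elim (fun hd => hd.mul_right _) fun hd => hd.mul_left _
    have h1 := (CharP.intCast_eq_zero_iff R 3 _).2 hdvd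
    rw [Int.cast_mul, Int.cast_sub, Int.cast_add, Int.cast_one, ← hz'] at h1
    linear_combination h1
  · rw [aeval_darcaisInt_three hg1] at hr
    have hr := (mul_eq_zero.1 hr).resolve_left hz
    have h3 : (3 : R) = 0 := by exact_mod_cast CharP.cast_eq_zero R 3
    have h1 := (CharP.intCast_eq_zero_iff R 3 _).2 hg3
    rw [Int.cast_sub, Int.cast_one] at h1
    linear_combination hr - 2 * h1 - (g 2 * z + 1) * h3

/-- A zero of an integer polynomial at a primitive `m`-th root of unity reduces to a zero at a
root of the `m`-th cyclotomic polynomial in any algebraically closed field. -/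
theorem exists_isRoot_cyclotomic_of_aeval_eq_zero (K : Type*) [Field K] [IsAlgClosed K]
    {p m : ℕ} [Fact p.Prime] [CharP K p] (hm : 0 < m) {ζ : ℂ} (hζ : IsPrimitiveRoot ζ m)
    {f : ℤ[X]} (hf : aeval ζ f = 0) :
    ∃ z : K, (cyclotomic m K).IsRoot z ∧ aeval z f = 0 := by
  have hdvd : cyclotomic m ℤ ∣ f := by
    rw [cyclotomic_eq_minpoly hζ hm]
    exact minpoly.isIntegrallyClosed_dvd (hζ.isIntegral hm) hf
  obtain ⟨z, hz⟩ := IsAlgClosed.exists_root (cyclotomic m K) (degree_cyclotomic_pos m K hm).ne'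
  refine ⟨z, hz, ?_⟩
  obtain ⟨q, rfl⟩ := hdvd
  rw [map_mul, aeval_def, ← eval_map, map_cyclotomic, hz.eq_zero, zero_mul]

/-- Theorem (Żmija): let `g(1) = 1` and suppose that all `P_n^g` are integer-valued
polynomials, and let `A_n^g := n! ⬝ P_n^g ∈ ℤ[x]`.  Assume that:
(1) no monic irreducible polynomial of degree 2 over `𝔽₅` divides `A_3^g` or `A_4^g`
mod 5; (2) no monic irreducible polynomial of degree 4 over `𝔽₇` divides `A_r^g`
mod 7 for `2 ≤ r ≤ 6`; (3) no monic irreducible polynomial over `𝔽₁₁` dividing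
`x^(11^6 - 1) - 1` but not `x^(11^d - 1) - 1` for all `1 ≤ d ≤ 10`, `d ≠ 6`, divides
`A_r^g` mod 11 for `2 ≤ r ≤ 10`.  Then `P_n^g(ζ) ≠ 0` for every root of unity `ζ` of
order `m ≥ 3` and every `n ≥ 1`.  (Here "the reduction mod `p` of `A_r^g`" is
formalized by quantifying over the integer polynomial `B` lifting `A_r^g`.) -/
theorem darcais_ne_zero_of_zmija_conditions (g : ℕ → ℤ) (hg1 : g 1 = 1)
    (hint : ∀ n : ℕ, 1 ≤ n → ∀ k : ℤ, ∃ z : ℤ, (darcais g n).eval (k : ℚ) = (z : ℚ))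
    (h5 : ∀ r ∈ ({3, 4} : Set ℕ), ∀ B : ℤ[X],
      B.map (Int.castRingHom ℚ) = darcaisA g r →
      ∀ q : (ZMod 5)[X], q.Monic → Irreducible q → q.natDegree = 2 →
        ¬ q ∣ B.map (Int.castRingHom (ZMod 5)))
    (h7 : ∀ r : ℕ, 2 ≤ r → r ≤ 6 → ∀ B : ℤ[X],
      B.map (Int.castRingHom ℚ) = darcaisA g r →
      ∀ q : (ZMod 7)[X], q.Monic → Irreducible q → q.natDegree = 4 →
        ¬ q ∣ B.map (Int.castRingHom (ZMod 7)))
    (h11 : ∀ r : ℕ, 2 ≤ r → r ≤ 10 → ∀ B : ℤ[X],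
      B.map (Int.castRingHom ℚ) = darcaisA g r →
      ∀ q : (ZMod 11)[X], q.Monic → Irreducible q →
        q ∣ (X ^ (11 ^ 6 - 1) - 1) →
        (∀ d : ℕ, 1 ≤ d → d ≤ 10 → d ≠ 6 → ¬ q ∣ (X ^ (11 ^ d - 1) - 1)) →
        ¬ q ∣ B.map (Int.castRingHom (ZMod 11)))
    (m : ℕ) (hm : 3 ≤ m) (ζ : ℂ) (hζ : IsPrimitiveRoot ζ m) (n : ℕ) (hn : 1 ≤ n) :
    aeval ζ (darcais g n) ≠ 0 := by
  intro h
  have hA := aeval_darcaisInt_eq_zero h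
  have : Fact (Nat.Prime 2) := ⟨Nat.prime_two⟩
  have : Fact (Nat.Prime 3) := ⟨Nat.prime_three⟩
  obtain ⟨a, m', hm', rfl⟩ :=
    Nat.exists_eq_pow_mul_and_not_dvd (n := m) (by omega) 2 (by norm_num)
  have hm0 : 0 < 2 ^ a * m' := by omega
  obtain rfl : m' = 1 := by
    obtain ⟨z, hz, hz0⟩ := exists_isRoot_cyclotomic_of_aeval_eq_zero
      (AlgebraicClosure (ZMod 2)) (p := 2) hm0 hζ hA
    have : NeZero (m' : AlgebraicClosure (ZMod 2)) :=
      ⟨fun h0 => hm' ((CharP.cast_eq_zero_iff _ 2 _).1 h0)⟩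
    have hprim := (isRoot_cyclotomic_prime_pow_mul_iff_of_charP (p := 2)).1 hz
    have hz1 := eq_one_of_aeval_darcaisInt_eq_zero hg1
      (hprim.ne_zero (fun h0 => hm' (h0 ▸ dvd_zero 2))) hz0
    exact Nat.dvd_one.1 (hprim.dvd_of_pow_eq_one 1 (by rw [hz1, one_pow]))
  rw [mul_one] at hm hm0 hζ
  obtain ⟨z, hz, hz0⟩ := exists_isRoot_cyclotomic_of_aeval_eq_zero
    (AlgebraicClosure (ZMod 3)) (p := 3) hm0 hζ hA
  have : NeZero ((2 ^ a : ℕ) : AlgebraicClosure (ZMod 3)) :=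
    ⟨fun h0 => absurd (Nat.prime_three.dvd_of_dvd_pow ((CharP.cast_eq_zero_iff _ 3 _).1 h0))
      (by norm_num)⟩
  have hprim := isRoot_cyclotomic_iff.1 hz
  have hg3 := three_dvd_sub_one hg1 (by simpa using hint 3 (by norm_num) 1)
  have hsq := sq_eq_one_of_aeval_darcaisInt_eq_zero hg1 hg3 (hprim.ne_zero hm0.ne') hz0
  have := Nat.le_of_dvd two_pos (hprim.dvd_of_pow_eq_one 2 hsq)
  omega
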